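/- Let α be a nonzero real number, U ⊆ ℝ × (0,∞) open, Φ : ℝ × ℝ → ℝ four times continuously differentiable on U, v : ℝ × ℝ → ℝ twice continuously differentiable on U, and h : ℝ → ℝ any function of the radial variable only. Write A(t,r) = 1 + α²r⁻²sin²(r·v(t,r)). Assume that on U: (i) ∂ₜΦ = A^{1/2}·∂ₜv, and (ii) ∂ₜₜΦ − ∂ᵣᵣΦ − 3r⁻¹∂ᵣΦ = α⁻²·(Φ − ∫₀^{v(t,r)} (1 + α²r⁻²sin²(ry))^{−3/2} dy) + h(r). Then on U the function Ψ := ∂ₜₜΦ satisfies ∂ₜₜΨ − ∂ᵣᵣΨ − 3r⁻¹∂ᵣΨ = α⁻²·( 2A⁻³·(∂ₜA)·(∂ₜΦ) + (1 − A⁻²)·Ψ ). -/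

import Mathlib

open MeasureTheory

/-- Partial derivative in the first (time) variable. -/
noncomputable def pdt (w : ℝ × ℝ → ℝ) : ℝ × ℝ → ℝ :=
  fun p => deriv (fun t => w (t, p.2)) p.1

/-- Partial derivative in the second (radial) variable. -/
noncomputable def pdr (w : ℝ × ℝ → ℝ) : ℝ × ℝ → ℝ :=
  fun p => deriv (fun r => w (p.1, r)) p.2

theorem hasDerivAt_pdt {w : ℝ × ℝ → ℝ} {p : ℝ × ℝ} (hw : DifferentiableAt ℝ w p) :
    HasDerivAt (fun t => w (t, p.2)) (pdt w p) p.1 := by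
  have hl : DifferentiableAt ℝ (fun t : ℝ => (t, p.2)) p.1 := by fun_prop
  exact (DifferentiableAt.comp (f := fun t : ℝ => (t, p.2)) p.1 hw hl).hasDerivAt

theorem pdt_eq_fderiv {w : ℝ × ℝ → ℝ} {p : ℝ × ℝ} (hw : DifferentiableAt ℝ w p) :
    pdt w p = fderiv ℝ w p (1, 0) := by
  have hl : HasDerivAt (fun t : ℝ => (t, p.2)) ((1 : ℝ), (0 : ℝ)) p.1 :=
    (hasDerivAt_id p.1).prodMk (hasDerivAt_const p.1 p.2)
  exact (HasFDerivAt.comp_hasDerivAt (f := fun t : ℝ => (t, p.2)) p.1 hw.hasFDerivAt hl).deriv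

theorem pdr_eq_fderiv {w : ℝ × ℝ → ℝ} {p : ℝ × ℝ} (hw : DifferentiableAt ℝ w p) :
    pdr w p = fderiv ℝ w p (0, 1) := by
  have hl : HasDerivAt (fun r : ℝ => (p.1, r)) ((0 : ℝ), (1 : ℝ)) p.2 :=
    (hasDerivAt_const p.2 p.1).prodMk (hasDerivAt_id p.2)
  exact (HasFDerivAt.comp_hasDerivAt (f := fun r : ℝ => (p.1, r)) p.2 hw.hasFDerivAt hl).deriv

theorem ContDiffOn.differentiableAt_of_isOpen {w : ℝ × ℝ → ℝ} {U : Set (ℝ × ℝ)} {n : ℕ}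
    (hw : ContDiffOn ℝ (n + 1) w U) (hU : IsOpen U) {p : ℝ × ℝ} (hp : p ∈ U) :
    DifferentiableAt ℝ w p :=
  (hw.contDiffAt (hU.mem_nhds hp)).differentiableAt (by simp)

theorem ContDiffOn.pdt_of_isOpen {w : ℝ × ℝ → ℝ} {U : Set (ℝ × ℝ)} {n : ℕ}
    (hw : ContDiffOn ℝ (n + 1) w U) (hU : IsOpen U) : ContDiffOn ℝ n (pdt w) U :=
  ((hw.fderiv_of_isOpen hU le_rfl).clm_apply contDiffOn_const).congr
    fun _ hp => pdt_eq_fderiv (hw.differentiableAt_of_isOpen hU hp)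

theorem ContDiffOn.pdr_of_isOpen {w : ℝ × ℝ → ℝ} {U : Set (ℝ × ℝ)} {n : ℕ}
    (hw : ContDiffOn ℝ (n + 1) w U) (hU : IsOpen U) : ContDiffOn ℝ n (pdr w) U :=
  ((hw.fderiv_of_isOpen hU le_rfl).clm_apply contDiffOn_const).congr
    fun _ hp => pdr_eq_fderiv (hw.differentiableAt_of_isOpen hU hp)

theorem eventually_slice_mem {U : Set (ℝ × ℝ)} (hU : IsOpen U) {p : ℝ × ℝ} (hp : p ∈ U) :
    ∀ᶠ t in nhds p.1, (t, p.2) ∈ U :=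
  (show Continuous fun t : ℝ => (t, p.2) by fun_prop).continuousAt.eventually_mem
    (hU.mem_nhds hp)

theorem pdr_congr {w z : ℝ × ℝ → ℝ} {U : Set (ℝ × ℝ)} (hU : IsOpen U)
    (hwz : ∀ p ∈ U, w p = z p) {p : ℝ × ℝ} (hp : p ∈ U) : pdr w p = pdr z p := by
  have hc : ∀ᶠ r in nhds p.2, (p.1, r) ∈ U :=
    (show Continuous fun r : ℝ => (p.1, r) by fun_prop).continuousAt.eventually_mem
      (hU.mem_nhds hp)
  exact Filter.EventuallyEq.deriv_eq (hc.mono fun r hr => hwz _ hr)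

theorem pdt_pdr_comm {w : ℝ × ℝ → ℝ} {U : Set (ℝ × ℝ)} (hU : IsOpen U)
    (hw : ContDiffOn ℝ 2 w U) {p : ℝ × ℝ} (hp : p ∈ U) :
    pdt (pdr w) p = pdr (pdt w) p := by
  have hw' : ContDiffOn ℝ ((1 : ℕ) + 1) w U := by simpa [one_add_one_eq_two] using hw
  have hd : DifferentiableAt ℝ (fderiv ℝ w) p :=
    ((hw'.fderiv_of_isOpen hU le_rfl).contDiffAt (hU.mem_nhds hp)).differentiableAt (by simp)
  have hsymm : IsSymmSndFDerivAt ℝ w p :=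
    (hw.contDiffAt (hU.mem_nhds hp)).isSymmSndFDerivAt (by simp)
  have key : ∀ a b : ℝ × ℝ, fderiv ℝ (fun q => fderiv ℝ w q a) p b
      = fderiv ℝ (fderiv ℝ w) p b a := fun a b => by
    rw [fderiv_clm_apply hd (differentiableAt_const a)]
    simp
  have ht : pdt w =ᶠ[nhds p] fun q => fderiv ℝ w q (1, 0) := by
    filter_upwards [hU.mem_nhds hp] with q hq
    exact pdt_eq_fderiv (hw'.differentiableAt_of_isOpen hU hq)
  have hr : pdr w =ᶠ[nhds p] fun q => fderiv ℝ w q (0, 1) := by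
    filter_upwards [hU.mem_nhds hp] with q hq
    exact pdr_eq_fderiv (hw'.differentiableAt_of_isOpen hU hq)
  have h1 : ContDiffOn ℝ ((0 : ℕ) + 1) (pdt w) U := by simpa using hw'.pdt_of_isOpen hU
  have h2 : ContDiffOn ℝ ((0 : ℕ) + 1) (pdr w) U := by simpa using hw'.pdr_of_isOpen hU
  rw [pdt_eq_fderiv (h2.differentiableAt_of_isOpen hU hp),
    pdr_eq_fderiv (h1.differentiableAt_of_isOpen hU hp), ht.fderiv_eq, hr.fderiv_eq, key, key]
  exact hsymm _ _

/-- The time derivative of the radial wave operator applied to a `C³` function `w` is the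
radial wave operator applied to `∂ₜw`. -/
theorem hasDerivAt_radialWave {w : ℝ × ℝ → ℝ} {U : Set (ℝ × ℝ)} (hU : IsOpen U)
    (hw : ContDiffOn ℝ 3 w U) {p : ℝ × ℝ} (hp : p ∈ U) :
    HasDerivAt (fun t => pdt (pdt w) (t, p.2) - pdr (pdr w) (t, p.2)
        - 3 * p.2⁻¹ * pdr w (t, p.2))
      (pdt (pdt (pdt w)) p - pdr (pdr (pdt w)) p - 3 * p.2⁻¹ * pdr (pdt w) p) p.1 := by
  have hw' : ContDiffOn ℝ ((2 : ℕ) + 1) w U := by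
    convert hw using 1; norm_num
  have hwt : ContDiffOn ℝ ((1 : ℕ) + 1) (pdt w) U := by
    convert hw'.pdt_of_isOpen hU using 1; norm_num
  have hwr : ContDiffOn ℝ ((1 : ℕ) + 1) (pdr w) U := by
    convert hw'.pdr_of_isOpen hU using 1; norm_num
  have htt : ContDiffOn ℝ ((0 : ℕ) + 1) (pdt (pdt w)) U := by simpa using hwt.pdt_of_isOpen hU
  have hrr : ContDiffOn ℝ ((0 : ℕ) + 1) (pdr (pdr w)) U := by simpa using hwr.pdr_of_isOpen hU
  have hw2 : ContDiffOn ℝ 2 w U := hw.of_le (by norm_num)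
  have hwr2 : ContDiffOn ℝ 2 (pdr w) U := hw'.pdr_of_isOpen hU
  have hcomm : pdr (pdr (pdt w)) p = pdt (pdr (pdr w)) p := by
    rw [pdt_pdr_comm hU hwr2 hp]
    exact pdr_congr hU (fun q hq => (pdt_pdr_comm hU hw2 hq).symm) hp
  rw [hcomm, ← pdt_pdr_comm hU hw2 hp]
  exact ((hasDerivAt_pdt (htt.differentiableAt_of_isOpen hU hp)).sub
    (hasDerivAt_pdt (hrr.differentiableAt_of_isOpen hU hp))).sub
    ((hasDerivAt_pdt (hwr.differentiableAt_of_isOpen hU hp)).const_mul _)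

theorem rpow_neg_three_halves_eq {a : ℝ} (ha : 0 < a) :
    a ^ (-(3 : ℝ) / 2) = (a ^ 2)⁻¹ * Real.sqrt a := by
  rw [Real.sqrt_eq_rpow, ← Real.rpow_natCast, ← Real.rpow_neg ha.le, ← Real.rpow_add ha]
  norm_num

theorem continuous_rpow_one_add_sin_sq (α r s : ℝ) :
    Continuous fun y : ℝ => (1 + α ^ 2 * Real.sin (r * y) ^ 2 / r ^ 2) ^ s := by
  refine Continuous.rpow_const (by fun_prop) fun y => Or.inl ?_
  positivity

/-- If `∂ₜΦ = A^{1/2}∂ₜv` and `Φ` solves the 4D radial wave equation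
`□Φ = α⁻²(Φ − ∫₀^v (1+α²r⁻²sin²(ry))^{−3/2} dy) + h(r)`, then `Ψ = ∂ₜₜΦ` solves
`□Ψ = α⁻²(2A⁻³(∂ₜA)(∂ₜΦ) + (1 − A⁻²)Ψ)`, where `□ = ∂ₜₜ − ∂ᵣᵣ − 3r⁻¹∂ᵣ`. -/
theorem stmt8 (α : ℝ) (hα : α ≠ 0) (U : Set (ℝ × ℝ)) (hU : IsOpen U)
    (hUsub : ∀ p ∈ U, 0 < p.2)
    (Φ v : ℝ × ℝ → ℝ) (hΦ : ContDiffOn ℝ 4 Φ U) (hv : ContDiffOn ℝ 2 v U)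
    (h : ℝ → ℝ)
    (A : ℝ × ℝ → ℝ)
    (hA : ∀ p : ℝ × ℝ, A p = 1 + α ^ 2 * Real.sin (p.2 * v p) ^ 2 / p.2 ^ 2)
    (hi : ∀ p ∈ U, pdt Φ p = Real.sqrt (A p) * pdt v p)
    (hii : ∀ p ∈ U,
      pdt (pdt Φ) p - pdr (pdr Φ) p - 3 * p.2⁻¹ * pdr Φ p
        = (α ^ 2)⁻¹ * (Φ p - ∫ y in (0 : ℝ)..(v p),
            (1 + α ^ 2 * Real.sin (p.2 * y) ^ 2 / p.2 ^ 2) ^ (-(3 : ℝ) / 2)) + h p.2) :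
    ∀ p ∈ U,
      pdt (pdt (pdt (pdt Φ))) p - pdr (pdr (pdt (pdt Φ))) p
          - 3 * p.2⁻¹ * pdr (pdt (pdt Φ)) p
        = (α ^ 2)⁻¹ * (2 * ((A p) ^ 3)⁻¹ * pdt A p * pdt Φ p
            + (1 - ((A p) ^ 2)⁻¹) * pdt (pdt Φ) p) := by
  have hΦ3 : ContDiffOn ℝ 3 Φ U := hΦ.of_le (by norm_num)
  have hΦt : ContDiffOn ℝ 3 (pdt Φ) U := by
    refine ContDiffOn.pdt_of_isOpen (n := 3) ?_ hU
    convert hΦ using 1; norm_num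
  have hApos : ∀ p, 0 < A p := fun p => by rw [hA]; positivity
  have hvd : ∀ p ∈ U, DifferentiableAt ℝ v p := fun p hp =>
    (hv.contDiffAt (hU.mem_nhds hp)).differentiableAt (by simp)
  have hAd : ∀ p ∈ U, DifferentiableAt ℝ A p := fun p hp => by
    rw [funext hA]
    have := hvd p hp
    have hr : p.2 ^ 2 ≠ 0 := pow_ne_zero 2 (hUsub p hp).ne'
    fun_prop (disch := assumption)
  have hstep : ∀ p ∈ U,
      pdt (pdt (pdt Φ)) p - pdr (pdr (pdt Φ)) p - 3 * p.2⁻¹ * pdr (pdt Φ) p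
        = (α ^ 2)⁻¹ * ((1 - ((A p) ^ 2)⁻¹) * pdt Φ p) := fun p hp => by
    have hI := (((continuous_rpow_one_add_sin_sq α p.2 (-(3 : ℝ) / 2)).integral_hasStrictDerivAt
      0 (v p)).hasDerivAt).comp p.1 (hasDerivAt_pdt (hvd p hp))
    have hΦd := hasDerivAt_pdt ((hΦ3.contDiffAt (hU.mem_nhds hp)).differentiableAt (by simp))
    have hR := ((hΦd.sub hI).const_mul (α ^ 2)⁻¹).add_const (h p.2)
    have heq := (hR.congr_of_eventuallyEq ((eventually_slice_mem hU hp).mono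
      fun t ht => hii _ ht)).unique (hasDerivAt_radialWave hU hΦ3 hp)
    rw [← heq, ← hA, rpow_neg_three_halves_eq (hApos p), mul_assoc, ← hi p hp]
    ring
  intro p hp
  have hAt := hasDerivAt_pdt (hAd p hp)
  have hG := hasDerivAt_pdt ((hΦt.contDiffAt (hU.mem_nhds hp)).differentiableAt (by simp))
  have hA0 : A p ≠ 0 := (hApos p).ne'
  have hR := ((((hAt.pow 2).inv (pow_ne_zero 2 hA0)).const_sub 1).mul hG).const_mul (α ^ 2)⁻¹
  have heq := (hR.congr_of_eventuallyEq ((eventually_slice_mem hU hp).mono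
    fun t ht => hstep _ ht)).unique (hasDerivAt_radialWave hU hΦt hp)
  rw [← heq]
  simp only [Pi.pow_apply, Pi.inv_apply, Prod.mk.eta]
  field_simp
  ring
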